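/- Let X, H, and H̃ be n×n complex Hermitian matrices and let f : ℝ → ℝ be twice continuously differentiable on an open interval (a,b). Suppose the eigenvalues of X + βH + αH̃ lie in (a,b) for all (α,β) in a neighborhood of (0,0), and let X = U Diag(λ₁,…,λₙ) U* be a spectral decomposition of X. Then the second mixed directional derivative of the function X ↦ Tr(F(X)) at X in the directions H and H̃, i.e. (d/dβ)|_{β=0} (d/dα)|_{α=0} Tr(F(X + βH + αH̃)), equals Tr( (X_{f'} ⊙ (U* H U)) · (U* H̃ U) ), where X_{f'} is the n×n matrix with entries [X_{f'}]_{ij} = (f')^{[1]}(λᵢ, λⱼ) and ⊙ is the Hadamard product. -/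

import Mathlib

open Matrix

/-- The matrix extension `F` of `f : ℝ → ℝ`: for Hermitian `A = U Diag(λ) U*`,
`F(A) := U Diag(f(λᵢ)) U*` (junk value `0` if `A` is not Hermitian). -/
noncomputable def matExt {𝕜 : Type*} [RCLike 𝕜] {n : Type*} [Fintype n] [DecidableEq n]
    (f : ℝ → ℝ) (A : Matrix n n 𝕜) : Matrix n n 𝕜 :=
  if hA : A.IsHermitian then
    (hA.eigenvectorUnitary : Matrix n n 𝕜) *
      Matrix.diagonal (fun i => (f (hA.eigenvalues i) : 𝕜)) *
      star (hA.eigenvectorUnitary : Matrix n n 𝕜)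
  else 0

/-- The eigenvalues of a Hermitian matrix (junk value `0` if not Hermitian). -/
noncomputable def eigs {𝕜 : Type*} [RCLike 𝕜] {n : Type*} [Fintype n] [DecidableEq n]
    (A : Matrix n n 𝕜) : n → ℝ :=
  if hA : A.IsHermitian then hA.eigenvalues else 0

/-- The first divided difference of `f`: `(f x − f y)/(x − y)` for `x ≠ y`, and `f'(x)`
on the diagonal. -/
noncomputable def divDiff (f : ℝ → ℝ) (x y : ℝ) : ℝ :=
  if x = y then deriv f x else (f x - f y) / (x - y)

open Filter Topology

theorem divDiff_mul_sub (g : ℝ → ℝ) (x y : ℝ) : divDiff g x y * (x - y) = g x - g y := by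
  unfold divDiff
  split_ifs with h
  · simp [h]
  · exact div_mul_cancel₀ _ (sub_ne_zero.mpr h)

/-- The divided difference of a `C¹` function is jointly continuous. -/
theorem continuousAt_divDiff {g : ℝ → ℝ} {x y : ℝ}
    (hx : ContDiffAt ℝ 1 g x) (hy : ContDiffAt ℝ 1 g y) :
    ContinuousAt (fun p : ℝ × ℝ => divDiff g p.1 p.2) (x, y) := by
  by_cases hxy : x = y
  · subst hxy
    have hstrict := hasStrictDerivAt_iff_hasStrictFDerivAt.mp (hx.hasStrictDerivAt one_ne_zero)
    have hlo := hasStrictFDerivAt_iff_isLittleO.mp hstrict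
    have hderiv : ContinuousAt (deriv g) x := by
      have := (hx.continuousAt_fderiv one_ne_zero).clm_apply
        (continuousAt_const (y := (1 : ℝ)))
      simpa only [fderiv_apply_one_eq_deriv] using this
    rw [Metric.continuousAt_iff']
    intro ε hε
    have hdiag : ∀ᶠ p : ℝ × ℝ in 𝓝 (x, x), dist (deriv g p.1) (deriv g x) < ε :=
      (continuousAt_fst (p := (x, x))).eventually (Metric.continuousAt_iff'.mp hderiv ε hε)
    filter_upwards [hlo.bound (half_pos hε), hdiag] with p hp hd
    have hxx : divDiff g x x = deriv g x := by simp [divDiff]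
    rw [hxx]
    by_cases hpe : p.1 = p.2
    · simpa [divDiff, hpe] using hd
    · have hne : p.1 - p.2 ≠ 0 := sub_ne_zero.mpr hpe
      have hpos : 0 < |p.1 - p.2| := abs_pos.mpr hne
      have heq : g p.1 - g p.2 - (p.1 - p.2) * deriv g x
          = (divDiff g p.1 p.2 - deriv g x) * (p.1 - p.2) := by
        rw [sub_mul (divDiff g p.1 p.2), divDiff_mul_sub]; ring
      simp only [ContinuousLinearMap.toSpanSingleton_apply, smul_eq_mul, Real.norm_eq_abs,
        heq, abs_mul] at hp
      have := le_of_mul_le_mul_right hp hpos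
      rw [Real.dist_eq]
      linarith
  · have hev : ∀ᶠ p : ℝ × ℝ in 𝓝 (x, y), (g p.1 - g p.2) / (p.1 - p.2) = divDiff g p.1 p.2 := by
      filter_upwards [(isOpen_ne_fun continuous_fst continuous_snd).mem_nhds
        (show (x, y).1 ≠ (x, y).2 from hxy)] with p hp
      simp [divDiff, show p.1 ≠ p.2 from hp]
    refine ContinuousAt.congr ?_ hev
    refine ContinuousAt.div₀ (.sub ?_ ?_) (by fun_prop) (sub_ne_zero.mpr hxy)
    · exact ContinuousAt.comp (f := Prod.fst) hx.continuousAt continuousAt_fst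
    · exact ContinuousAt.comp (f := Prod.snd) hy.continuousAt continuousAt_snd

theorem tendsto_trace_hadamard_mul {n ι : Type*} [Fintype n] {L : Filter ι} {φ : ι → n → n → ℂ}
    {P Q : ι → Matrix n n ℂ} {φ₀ : n → n → ℂ} {P₀ Q₀ : Matrix n n ℂ}
    (hφ : ∀ i j, Tendsto (fun t => φ t i j) L (𝓝 (φ₀ i j))) (hP : Tendsto P L (𝓝 P₀))
    (hQ : Tendsto Q L (𝓝 Q₀)) :
    Tendsto (fun t => (hadamard (of (φ t)) (P t) * Q t).trace) L
      (𝓝 (hadamard (of φ₀) P₀ * Q₀).trace) := by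
  have hentry : ∀ (i j : n), Continuous fun B : Matrix n n ℂ => B i j := fun i j => by fun_prop
  simp only [Matrix.trace, diag_apply, Matrix.mul_apply, hadamard_apply, of_apply]
  exact tendsto_finsetSum _ fun i _ => tendsto_finsetSum _ fun j _ =>
    ((hφ i j).mul (((hentry i j).tendsto P₀).comp hP)).mul (((hentry j i).tendsto Q₀).comp hQ)

section Spectral

variable {n : Type*} [Fintype n] [DecidableEq n]

theorem conjTranspose_mul_self_of_mem_unitaryGroup {U : Matrix n n ℂ}
    (hU : U ∈ unitaryGroup n ℂ) : Uᴴ * U = 1 :=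
  mem_unitaryGroup_iff'.mp hU

theorem mul_conjTranspose_self_of_mem_unitaryGroup {U : Matrix n n ℂ}
    (hU : U ∈ unitaryGroup n ℂ) : U * Uᴴ = 1 :=
  mem_unitaryGroup_iff.mp hU

/-- The change of basis between two spectral decompositions only links equal eigenvalues. -/
theorem eq_of_spectral_decompositions {U V : Matrix n n ℂ} (hU : U ∈ unitaryGroup n ℂ)
    (hV : V ∈ unitaryGroup n ℂ) {l m : n → ℝ}
    (h : U * diagonal (fun i => (l i : ℂ)) * Uᴴ = V * diagonal (fun i => (m i : ℂ)) * Vᴴ)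
    {i j : n} (hij : (Uᴴ * V) i j ≠ 0) : l i = m j := by
  have h1 : diagonal (fun i => (l i : ℂ)) * (Uᴴ * V)
      = (Uᴴ * V) * diagonal (fun i => (m i : ℂ)) := by
    calc diagonal (fun i => (l i : ℂ)) * (Uᴴ * V)
        = (Uᴴ * U) * diagonal (fun i => (l i : ℂ)) * (Uᴴ * V) := by
          rw [conjTranspose_mul_self_of_mem_unitaryGroup hU, one_mul]
      _ = Uᴴ * (U * diagonal (fun i => (l i : ℂ)) * Uᴴ) * V := by simp only [mul_assoc]
      _ = Uᴴ * V * diagonal (fun i => (m i : ℂ)) * (Vᴴ * V) := by rw [h]; simp only [mul_assoc]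
      _ = _ := by rw [conjTranspose_mul_self_of_mem_unitaryGroup hV, mul_one]
  have h2 := congrFun (congrFun h1 i) j
  rw [diagonal_mul, mul_diagonal, mul_comm] at h2
  exact_mod_cast mul_left_cancel₀ hij h2

/-- Every eigenvalue of one spectral decomposition occurs in any other one. -/
theorem exists_eq_of_spectral_decompositions {U V : Matrix n n ℂ} (hU : U ∈ unitaryGroup n ℂ)
    (hV : V ∈ unitaryGroup n ℂ) {l m : n → ℝ}
    (h : U * diagonal (fun i => (l i : ℂ)) * Uᴴ = V * diagonal (fun i => (m i : ℂ)) * Vᴴ)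
    (i : n) : ∃ j, l i = m j := by
  by_contra! hne
  have hrow : ∀ j, (Uᴴ * V) i j = 0 := fun j => by
    by_contra hij
    exact hne j (eq_of_spectral_decompositions hU hV h hij)
  have hone : (Uᴴ * V) * (Vᴴ * U) = 1 := by
    calc (Uᴴ * V) * (Vᴴ * U) = Uᴴ * (V * Vᴴ) * U := by simp only [mul_assoc]
      _ = 1 := by rw [mul_conjTranspose_self_of_mem_unitaryGroup hV, mul_one,
            conjTranspose_mul_self_of_mem_unitaryGroup hU]
  have hii := congrFun (congrFun hone i) i
  rw [Matrix.mul_apply] at hii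
  simp [hrow] at hii

theorem exists_spectral_decomposition {A : Matrix n n ℂ} (hA : A.IsHermitian) :
    ∃ V ∈ unitaryGroup n ℂ, A = V * diagonal (fun i => (eigs A i : ℂ)) * Vᴴ ∧
      ∀ g, matExt g A = V * diagonal (fun i => (g (eigs A i) : ℂ)) * Vᴴ := by
  refine ⟨hA.eigenvectorUnitary, hA.eigenvectorUnitary.2, ?_, fun g => ?_⟩
  · simp only [eigs, hA, dif_pos]
    exact hA.spectral_theorem
  · simp only [eigs, matExt, hA, dif_pos]
    rfl

/-- The matrix extension can be computed from any spectral decomposition. -/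
theorem matExt_eq {A U : Matrix n n ℂ} (hA : A.IsHermitian) (hU : U ∈ unitaryGroup n ℂ)
    {l : n → ℝ} (hAU : A = U * diagonal (fun i => (l i : ℂ)) * Uᴴ) (g : ℝ → ℝ) :
    matExt g A = U * diagonal (fun i => (g (l i) : ℂ)) * Uᴴ := by
  obtain ⟨V, hV, hAV, hg⟩ := exists_spectral_decomposition hA
  rw [hg]
  have h : (Uᴴ * V) * diagonal (fun i => (g (eigs A i) : ℂ))
      = diagonal (fun i => (g (l i) : ℂ)) * (Uᴴ * V) := by
    ext i j
    rw [diagonal_mul, mul_diagonal, mul_comm]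
    by_cases hij : (Uᴴ * V) i j = 0
    · simp [hij]
    · rw [eq_of_spectral_decompositions hU hV (hAU.symm.trans hAV) hij]
  calc V * diagonal (fun i => (g (eigs A i) : ℂ)) * Vᴴ
      = (U * Uᴴ) * V * diagonal (fun i => (g (eigs A i) : ℂ)) * Vᴴ := by
        rw [mul_conjTranspose_self_of_mem_unitaryGroup hU, one_mul]
    _ = U * ((Uᴴ * V) * diagonal (fun i => (g (eigs A i) : ℂ))) * Vᴴ := by
        simp only [mul_assoc]
    _ = U * diagonal (fun i => (g (l i) : ℂ)) * Uᴴ * (V * Vᴴ) := by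
        rw [h]; simp only [mul_assoc]
    _ = _ := by rw [mul_conjTranspose_self_of_mem_unitaryGroup hV, mul_one]

/-- The Hadamard multiplier of divided differences turns the difference of two diagonalized
matrices into the difference of their matrix extensions. -/
theorem hadamard_divDiff_sub {V U : Matrix n n ℂ} (hV : V ∈ unitaryGroup n ℂ)
    (hU : U ∈ unitaryGroup n ℂ) (m l : n → ℝ) (g : ℝ → ℝ) :
    hadamard (of fun i j => (divDiff g (m i) (l j) : ℂ))
        (Vᴴ * (V * diagonal (fun i => (m i : ℂ)) * Vᴴ
          - U * diagonal (fun i => (l i : ℂ)) * Uᴴ) * U)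
      = Vᴴ * (V * diagonal (fun i => (g (m i) : ℂ)) * Vᴴ
          - U * diagonal (fun i => (g (l i) : ℂ)) * Uᴴ) * U := by
  have key : ∀ d e : n → ℂ, Vᴴ * (V * diagonal d * Vᴴ - U * diagonal e * Uᴴ) * U
      = diagonal d * (Vᴴ * U) - (Vᴴ * U) * diagonal e := by
    intro d e
    calc Vᴴ * (V * diagonal d * Vᴴ - U * diagonal e * Uᴴ) * U
        = (Vᴴ * V) * diagonal d * (Vᴴ * U) - Vᴴ * U * diagonal e * (Uᴴ * U) := by
          simp only [mul_sub, sub_mul, mul_assoc]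
      _ = _ := by
          rw [conjTranspose_mul_self_of_mem_unitaryGroup hU,
            conjTranspose_mul_self_of_mem_unitaryGroup hV, one_mul, mul_one]
  rw [key, key]
  ext i j
  have hd : (divDiff g (m i) (l j) : ℂ) * ((m i : ℂ) - l j) = g (m i) - g (l j) := by
    exact_mod_cast divDiff_mul_sub g (m i) (l j)
  simp only [hadamard_apply, of_apply, Matrix.sub_apply, diagonal_mul, mul_diagonal]
  linear_combination (Vᴴ * U) i j * hd

/-- Replacing the left spectral decomposition does not change the double operator sum. -/
theorem trace_hadamard_divDiff_congr {U W : Matrix n n ℂ} (hU : U ∈ unitaryGroup n ℂ)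
    (hW : W ∈ unitaryGroup n ℂ) {l m : n → ℝ}
    (h : U * diagonal (fun i => (l i : ℂ)) * Uᴴ = W * diagonal (fun i => (m i : ℂ)) * Wᴴ)
    (g : ℝ → ℝ) (H M : Matrix n n ℂ) :
    (hadamard (of fun i j => (divDiff g (m i) (l j) : ℂ)) (Wᴴ * H * U) * (Uᴴ * M * W)).trace
      = (hadamard (of fun i j => (divDiff g (l i) (l j) : ℂ)) (Uᴴ * H * U)
          * (Uᴴ * M * U)).trace := by
  have hUW : U * (Uᴴ * W) = W := by
    rw [← mul_assoc, mul_conjTranspose_self_of_mem_unitaryGroup hU, one_mul]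
  have hWU : (Wᴴ * U) * Uᴴ = Wᴴ := by
    rw [mul_assoc, mul_conjTranspose_self_of_mem_unitaryGroup hU, mul_one]
  have hQQ : (Uᴴ * W) * (Wᴴ * U) = 1 := by
    rw [mul_assoc, ← mul_assoc W, mul_conjTranspose_self_of_mem_unitaryGroup hW, one_mul,
      conjTranspose_mul_self_of_mem_unitaryGroup hU]
  have hH : hadamard (of fun i j => (divDiff g (m i) (l j) : ℂ)) (Wᴴ * H * U)
      = (Wᴴ * U) * hadamard (of fun i j => (divDiff g (l i) (l j) : ℂ)) (Uᴴ * H * U) := by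
    have hsplit : Wᴴ * H * U = (Wᴴ * U) * (Uᴴ * H * U) := by
      rw [← mul_assoc, ← mul_assoc, hWU]
    rw [hsplit]
    ext i j
    simp only [hadamard_apply, of_apply, Matrix.mul_apply (M := Wᴴ * U), Finset.mul_sum]
    refine Finset.sum_congr rfl fun k _ => ?_
    by_cases hik : (Wᴴ * U) i k = 0
    · simp [hik]
    · rw [eq_of_spectral_decompositions hW hU h.symm hik]
      ring
  have hM : Uᴴ * M * W = (Uᴴ * M * U) * (Uᴴ * W) := by
    rw [mul_assoc _ U, hUW]
  rw [hH, hM, mul_assoc (Wᴴ * U), Matrix.trace_mul_comm, mul_assoc, mul_assoc (Uᴴ * M * U), hQQ,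
    mul_one]

theorem isCompact_unitaryGroup : IsCompact (unitaryGroup n ℂ : Set (Matrix n n ℂ)) := by
  have hK : IsCompact (Set.univ.pi fun _ : n => Set.univ.pi fun _ : n =>
      Metric.closedBall (0 : ℂ) 1) :=
    isCompact_univ_pi fun _ => isCompact_univ_pi fun _ => isCompact_closedBall 0 1
  refine IsCompact.of_isClosed_subset hK ?_ fun U hU i _ j _ => ?_
  · have : (unitaryGroup n ℂ : Set (Matrix n n ℂ)) = {U | U * Uᴴ = 1} := by
      ext U
      exact mem_unitaryGroup_iff
    rw [this]
    exact isClosed_eq (by fun_prop) continuous_const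
  · simpa using entry_norm_bound_of_unitary hU i j

/-- Along diagonalizations of matrices converging to `U Diag(l) U*`, the trace of the double
operator sum of divided differences converges, although the diagonalizations themselves need not. -/
theorem tendsto_trace_hadamard_divDiff {ι : Type*} {L : Filter ι} {V : ι → Matrix n n ℂ}
    (hV : ∀ t, V t ∈ unitaryGroup n ℂ) {m : ι → n → ℝ} {U : Matrix n n ℂ}
    (hU : U ∈ unitaryGroup n ℂ) {l : n → ℝ}
    (hVU : Tendsto (fun t => V t * diagonal (fun i => (m t i : ℂ)) * (V t)ᴴ) L
      (𝓝 (U * diagonal (fun i => (l i : ℂ)) * Uᴴ))) {g : ℝ → ℝ}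
    (hg : ∀ i, ContDiffAt ℝ 1 g (l i)) (H M : Matrix n n ℂ) :
    Tendsto (fun t => (hadamard (of fun i j => (divDiff g (m t i) (l j) : ℂ)) ((V t)ᴴ * H * U)
        * (Uᴴ * M * V t)).trace) L
      (𝓝 (hadamard (of fun i j => (divDiff g (l i) (l j) : ℂ)) (Uᴴ * H * U)
        * (Uᴴ * M * U)).trace) := by
  rw [tendsto_iff_ultrafilter]
  intro u hu
  obtain ⟨W, hW, hVW⟩ := isCompact_unitaryGroup.ultrafilter_le_nhds' (u.map V)
    (Ultrafilter.mem_map.mpr (Filter.univ_mem' hV))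
  have hVW' : Tendsto V u (𝓝 W) := hVW
  have hVWs : Tendsto (fun t => (V t)ᴴ) u (𝓝 Wᴴ) :=
    (continuous_id.matrix_conjTranspose.tendsto W).comp hVW'
  set A := U * diagonal (fun i => (l i : ℂ)) * Uᴴ with hA
  have hdiag : Tendsto (fun t => diagonal (fun i => (m t i : ℂ))) u (𝓝 (Wᴴ * A * W)) := by
    refine ((hVWs.mul (hVU.mono_left hu)).mul hVW').congr fun t => ?_
    calc (V t)ᴴ * (V t * diagonal (fun i => (m t i : ℂ)) * (V t)ᴴ) * V t
        = ((V t)ᴴ * V t) * diagonal (fun i => (m t i : ℂ)) * ((V t)ᴴ * V t) := by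
          simp only [mul_assoc]
      _ = _ := by
          rw [conjTranspose_mul_self_of_mem_unitaryGroup (hV t), one_mul, mul_one]
  set μ : n → ℝ := fun i => ((Wᴴ * A * W) i i).re with hμ
  have hmμ : ∀ i, Tendsto (fun t => m t i) u (𝓝 (μ i)) := fun i => by
    have hc : Continuous fun B : Matrix n n ℂ => (B i i).re := by fun_prop
    exact ((hc.tendsto _).comp hdiag).congr fun t => by simp
  have hWA : Wᴴ * A * W = diagonal (fun i => (μ i : ℂ)) := by
    refine tendsto_nhds_unique hdiag ?_
    have hc : Continuous fun v : n → ℝ => diagonal (fun i => (v i : ℂ)) := by fun_prop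
    exact (hc.tendsto μ).comp (tendsto_pi_nhds.mpr hmμ)
  have hAW : A = W * diagonal (fun i => (μ i : ℂ)) * Wᴴ := by
    rw [← hWA]
    calc A = (W * Wᴴ) * A * (W * Wᴴ) := by
          rw [mul_conjTranspose_self_of_mem_unitaryGroup hW, one_mul, mul_one]
      _ = _ := by simp only [mul_assoc]
  have hgμ : ∀ i, ContDiffAt ℝ 1 g (μ i) := fun i => by
    obtain ⟨j, hj⟩ := exists_eq_of_spectral_decompositions hW hU hAW.symm i
    exact hj ▸ hg j
  rw [← trace_hadamard_divDiff_congr hU hW hAW]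
  have hφ : ∀ i j, Tendsto (fun t => divDiff g (m t i) (l j)) u (𝓝 (divDiff g (μ i) (l j))) :=
    fun i j => (continuousAt_divDiff (hgμ i) (hg j)).tendsto.comp
      ((hmμ i).prodMk_nhds tendsto_const_nhds)
  refine tendsto_trace_hadamard_mul (fun i j => (Complex.continuous_ofReal.tendsto _).comp (hφ i j))
    ?_ ?_
  · exact (hVWs.mul tendsto_const_nhds).mul tendsto_const_nhds
  · exact tendsto_const_nhds.mul hVW'

/-- Daleckii–Krein formula, tested against the matrix `M`. -/
theorem hasDerivAt_trace_matExt_mul {A H U : Matrix n n ℂ} (hA : A.IsHermitian)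
    (hH : H.IsHermitian) (hU : U ∈ unitaryGroup n ℂ) {l : n → ℝ}
    (hAU : A = U * diagonal (fun i => (l i : ℂ)) * Uᴴ) {g : ℝ → ℝ}
    (hg : ∀ i, ContDiffAt ℝ 1 g (l i)) (M : Matrix n n ℂ) :
    HasDerivAt (fun t : ℝ => (matExt g (A + (t : ℂ) • H) * M).trace)
      ((hadamard (of fun i j => (divDiff g (l i) (l j) : ℂ)) (Uᴴ * H * U)
        * (Uᴴ * M * U)).trace) 0 := by
  have hherm : ∀ t : ℝ, (A + (t : ℂ) • H).IsHermitian := fun t => by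
    refine hA.add ?_
    rw [IsHermitian, conjTranspose_smul, hH.eq]
    simp
  choose V hV hAV hgV using fun t => exists_spectral_decomposition (hherm t)
  set m : ℝ → n → ℝ := fun t => eigs (A + (t : ℂ) • H) with hm
  have hslope : ∀ t : ℝ, t ≠ 0 →
      t⁻¹ • ((matExt g (A + ((0 + t : ℝ) : ℂ) • H) * M).trace
        - (matExt g (A + ((0 : ℝ) : ℂ) • H) * M).trace)
      = (hadamard (of fun i j => (divDiff g (m t i) (l j) : ℂ)) ((V t)ᴴ * H * U)
          * (Uᴴ * M * V t)).trace := by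
    intro t ht
    have htc : (t : ℂ) ≠ 0 := by exact_mod_cast ht
    have hdiff : V t * diagonal (fun i => (m t i : ℂ)) * (V t)ᴴ
        - U * diagonal (fun i => (l i : ℂ)) * Uᴴ = (t : ℂ) • H := by
      rw [← hAU, ← hAV, add_sub_cancel_left]
    have hD := hadamard_divDiff_sub (hV t) hU (m t) l g
    rw [hdiff, Matrix.mul_smul, Matrix.smul_mul, hadamard_smul] at hD
    have h0 : matExt g (A + ((0 : ℝ) : ℂ) • H) = U * diagonal (fun i => (g (l i) : ℂ)) * Uᴴ := by
      simpa using matExt_eq hA hU hAU g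
    have htr : ∀ B : Matrix n n ℂ, ((V t)ᴴ * B * U * (Uᴴ * M * V t)).trace = (B * M).trace := by
      intro B
      calc ((V t)ᴴ * B * U * (Uᴴ * M * V t)).trace
          = ((V t)ᴴ * (B * (U * Uᴴ) * M * V t)).trace := by simp only [mul_assoc]
        _ = (B * M * (V t * (V t)ᴴ)).trace := by
            rw [mul_conjTranspose_self_of_mem_unitaryGroup hU, mul_one, Matrix.trace_mul_comm,
              mul_assoc]
        _ = _ := by rw [mul_conjTranspose_self_of_mem_unitaryGroup (hV t), mul_one]
    rw [zero_add, h0, hgV t, ← Matrix.trace_sub, ← sub_mul, ← htr, ← hD, Matrix.smul_mul,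
      Matrix.trace_smul]
    simp [htc]
  rw [hasDerivAt_iff_tendsto_slope_zero]
  refine Tendsto.congr' (f₁ := fun t : ℝ =>
    (hadamard (of fun i j => (divDiff g (m t i) (l j) : ℂ)) ((V t)ᴴ * H * U)
          * (Uᴴ * M * V t)).trace) ?_ ?_
  · filter_upwards [self_mem_nhdsWithin] with t ht
    exact (hslope t ht).symm
  have hc : Continuous fun t : ℝ => A + (t : ℂ) • H := by fun_prop
  refine tendsto_trace_hadamard_divDiff hV hU ?_ hg H M
  rw [← hAU]
  simp only [hm, ← hAV]
  refine Tendsto.mono_left ?_ nhdsWithin_le_nhds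
  convert hc.tendsto 0 using 2
  simp

/-- The first derivative of a spectral trace function. -/
theorem hasDerivAt_trace_matExt {A H U : Matrix n n ℂ} (hA : A.IsHermitian)
    (hH : H.IsHermitian) (hU : U ∈ unitaryGroup n ℂ) {l : n → ℝ}
    (hAU : A = U * diagonal (fun i => (l i : ℂ)) * Uᴴ) {g : ℝ → ℝ}
    (hg : ∀ i, ContDiffAt ℝ 1 g (l i)) :
    HasDerivAt (fun t : ℝ => (matExt g (A + (t : ℂ) • H)).trace)
      ((matExt (deriv g) A * H).trace) 0 := by
  have h := hasDerivAt_trace_matExt_mul hA hH hU hAU hg 1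
  simp only [mul_one] at h
  convert h using 1
  rw [conjTranspose_mul_self_of_mem_unitaryGroup hU, mul_one, matExt_eq hA hU hAU, mul_assoc,
    mul_assoc, Matrix.trace_mul_comm, mul_assoc]
  simp [Matrix.trace, divDiff, diagonal_mul]

end Spectral

/-- For Hermitian `X, H, H̃`, `f` twice continuously differentiable on `(a,b)`, eigenvalues of
`X + βH + αH̃` in `(a,b)` near `(0,0)`, and a spectral decomposition `X = U Diag(λ) U*`,
the second mixed directional derivative `(d/dβ)|₀ (d/dα)|₀ Tr F(X + βH + αH̃)` equals
`Tr((X_{f'} ⊙ (U* H U)) (U* H̃ U))`, where `[X_{f'}]_{ij} = (f')^{[1]}(λᵢ,λⱼ)`. -/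
theorem trace_matExt_second_derivative {n : ℕ} (X H Ht : Matrix (Fin n) (Fin n) ℂ)
    (hX : X.IsHermitian) (hH : H.IsHermitian) (hHt : Ht.IsHermitian)
    (a b : ℝ) (f : ℝ → ℝ) (hf : ContDiffOn ℝ 2 f (Set.Ioo a b))
    (U : Matrix (Fin n) (Fin n) ℂ) (hU : U ∈ Matrix.unitaryGroup (Fin n) ℂ)
    (lam : Fin n → ℝ) (hXdec : X = U * Matrix.diagonal (fun i => (lam i : ℂ)) * Uᴴ)
    (hspec : ∃ ε > 0, ∀ α β : ℝ, |α| < ε → |β| < ε →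
      ∀ i, eigs (X + (β : ℂ) • H + (α : ℂ) • Ht) i ∈ Set.Ioo a b) :
    HasDerivAt
      (fun β : ℝ =>
        deriv (fun α : ℝ => (matExt f (X + (β : ℂ) • H + (α : ℂ) • Ht)).trace) 0)
      ((Matrix.hadamard (Matrix.of fun i j => (divDiff (deriv f) (lam i) (lam j) : ℂ))
          (Uᴴ * H * U) * (Uᴴ * Ht * U)).trace) 0 := by
  obtain ⟨ε, hε, hspec⟩ := hspec
  have hherm : ∀ β : ℝ, (X + (β : ℂ) • H).IsHermitian := fun β => by
    refine hX.add ?_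
    rw [IsHermitian, conjTranspose_smul, hH.eq]
    simp
  have hmem : ∀ β : ℝ, |β| < ε → ∀ i, eigs (X + (β : ℂ) • H) i ∈ Set.Ioo a b := by
    intro β hβ i
    simpa using hspec 0 β (by simpa using hε) hβ i
  have hlam : ∀ i, lam i ∈ Set.Ioo a b := by
    intro i
    obtain ⟨V, hV, hXV, -⟩ := exists_spectral_decomposition hX
    obtain ⟨j, hj⟩ := exists_eq_of_spectral_decompositions hU hV (hXdec.symm.trans hXV) i
    rw [hj]
    simpa using hmem 0 (by simpa using hε) j
  have hf1 : ∀ x ∈ Set.Ioo a b, ContDiffAt ℝ 1 f x := fun x hx =>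
    (hf.contDiffAt (isOpen_Ioo.mem_nhds hx)).of_le one_le_two
  have hf2 : ∀ x ∈ Set.Ioo a b, ContDiffAt ℝ 1 (deriv f) x := fun x hx =>
    (hf.deriv_of_isOpen isOpen_Ioo (by norm_num)).contDiffAt (isOpen_Ioo.mem_nhds hx)
  refine (hasDerivAt_trace_matExt_mul hX hH hU hXdec
    (fun i => hf2 _ (hlam i)) Ht).congr_of_eventuallyEq ?_
  have hball : ∀ᶠ β : ℝ in 𝓝 0, |β| < ε := by
    filter_upwards [Metric.ball_mem_nhds (0 : ℝ) hε] with β hβ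
    simpa using hβ
  filter_upwards [hball] with β hβ
  obtain ⟨V, hV, hXV, -⟩ := exists_spectral_decomposition (hherm β)
  exact (hasDerivAt_trace_matExt (hherm β) hHt hV hXV fun i => hf1 _ (hmem β hβ i)).deriv
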